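/- If x and y are comparable elements of K with a, c ≤ x and a, c ≤ y, then the 1-simplices [a^x c] and [a^y c] are equal: (a,x)*\overline{(x,c)} = (a,y)*\overline{(y,c)}. -/

import Mathlib

/-- The path semigroup `S` on a poset `K`, presented by generators and relations.
`down a b h` is the elementary path `(a,b)` (with `a ≤ b`) from `b` down to `a`;
`up a b h` is the elementary path `\overline{(a,b)}` (with `b ≤ a`) from `b` up to `a`;
`idem a` is the trivial path `i_a`; `zero` is the empty path `0`;
`src` is the starting point `∂₁` and `tgt` the ending point `∂₀` (both `none` only on `0`). -/
structure PathSemigroup (K : Type*) [PartialOrder K] where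
  S : Type*
  mul : S → S → S
  zero : S
  idem : K → S
  down : (a b : K) → a ≤ b → S
  up : (a b : K) → b ≤ a → S
  src : S → Option K
  tgt : S → Option K
  inv : S → S
  mul_assoc : ∀ p q r : S, mul (mul p q) r = mul p (mul q r)
  zero_mul : ∀ p : S, mul zero p = zero
  mul_zero : ∀ p : S, mul p zero = zero
  src_eq_none : ∀ p : S, src p = none ↔ p = zero
  tgt_eq_none : ∀ p : S, tgt p = none ↔ p = zero
  src_idem : ∀ a : K, src (idem a) = some a
  tgt_idem : ∀ a : K, tgt (idem a) = some a
  src_down : ∀ (a b : K) (h : a ≤ b), src (down a b h) = some b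
  tgt_down : ∀ (a b : K) (h : a ≤ b), tgt (down a b h) = some a
  src_up : ∀ (a b : K) (h : b ≤ a), src (up a b h) = some b
  tgt_up : ∀ (a b : K) (h : b ≤ a), tgt (up a b h) = some a
  mul_eq_zero_iff : ∀ p q : S, mul p q = zero ↔ (p = zero ∨ q = zero ∨ src p ≠ tgt q)
  src_mul : ∀ p q : S, mul p q ≠ zero → src (mul p q) = src q
  tgt_mul : ∀ p q : S, mul p q ≠ zero → tgt (mul p q) = tgt p
  inv_zero : inv zero = zero
  inv_idem : ∀ a : K, inv (idem a) = idem a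
  inv_down : ∀ (a b : K) (h : a ≤ b), inv (down a b h) = up b a h
  inv_up : ∀ (a b : K) (h : b ≤ a), inv (up a b h) = down b a h
  inv_inv : ∀ p : S, inv (inv p) = p
  src_inv : ∀ p : S, src (inv p) = tgt p
  tgt_inv : ∀ p : S, tgt (inv p) = src p
  inv_mul : ∀ p q : S, inv (mul p q) = mul (inv q) (inv p)
  down_mul_down : ∀ (a b c : K) (hab : a ≤ b) (hbc : b ≤ c),
    mul (down a b hab) (down b c hbc) = down a c (le_trans hab hbc)
  up_mul_up : ∀ (a b c : K) (hab : a ≤ b) (hbc : b ≤ c),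
    mul (up c b hbc) (up b a hab) = up c a (le_trans hab hbc)
  up_mul_down : ∀ (a b : K) (h : a ≤ b), mul (up b a h) (down a b h) = idem b
  down_mul_up : ∀ (a b : K) (h : a ≤ b), mul (down a b h) (up b a h) = idem a
  down_mul_idem : ∀ (a b : K) (h : a ≤ b), mul (down a b h) (idem b) = down a b h
  idem_mul_down : ∀ (a b : K) (h : a ≤ b), mul (idem a) (down a b h) = down a b h
  up_mul_idem : ∀ (a b : K) (h : b ≤ a), mul (up a b h) (idem b) = up a b h
  idem_mul_up : ∀ (a b : K) (h : b ≤ a), mul (idem a) (up a b h) = up a b h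
  idem_mul_idem : ∀ a : K, mul (idem a) (idem a) = idem a
  generated : ∀ p : S, p ≠ zero → ∀ P : S → Prop,
    (∀ a : K, P (idem a)) →
    (∀ (a b : K) (h : a ≤ b), P (down a b h)) →
    (∀ (a b : K) (h : b ≤ a), P (up a b h)) →
    (∀ x y : S, P x → P y → mul x y ≠ zero → P (mul x y)) →
    P p

namespace PathSemigroup

variable {K : Type*} [PartialOrder K]

/-- The 1-simplex `[a^x c] = (a,x) * \overline{(x,c)}` with support `x`. -/
def simplex (P : PathSemigroup K) (a x c : K) (h1 : a ≤ x) (h2 : c ≤ x) : P.S :=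
  P.mul (P.down a x h1) (P.up x c h2)

/-- The set `G_a` of loops that start and end at `a`. -/
def Loop (P : PathSemigroup K) (a : K) : Set P.S :=
  {p | p ≠ P.zero ∧ P.tgt p = some a ∧ P.src p = some a}

end PathSemigroup

theorem simplex_eq_of_le_aux {K : Type*} [PartialOrder K] (P : PathSemigroup K)
    (a c x y : K) (hxy : x ≤ y)
    (hax : a ≤ x) (hcx : c ≤ x) (hay : a ≤ y) (hcy : c ≤ y) :
    P.simplex a x c hax hcx = P.simplex a y c hay hcy := by
  unfold PathSemigroup.simplex
  rw [← P.down_mul_down a x y hax hxy, ← P.up_mul_up c x y hcx hxy, P.mul_assoc,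
    ← P.mul_assoc (P.down x y hxy), P.down_mul_up, P.idem_mul_up]

/-- If `x` and `y` are comparable and `a, c ≤ x`, `a, c ≤ y`, then the 1-simplices
`[a^x c]` and `[a^y c]` are equal. -/
theorem statement7 {K : Type*} [PartialOrder K] (P : PathSemigroup K)
    (a c x y : K) (hcomp : x ≤ y ∨ y ≤ x)
    (hax : a ≤ x) (hcx : c ≤ x) (hay : a ≤ y) (hcy : c ≤ y) :
    P.simplex a x c hax hcx = P.simplex a y c hay hcy := by
  rcases hcomp with h | h
  · exact simplex_eq_of_le_aux P a c x y h hax hcx hay hcy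
  · exact (simplex_eq_of_le_aux P a c y x h hay hcy hax hcx).symm
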